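/- Let m, n be positive integers and σ > 0. Let W be a random real m×n matrix whose entries are independent centered Gaussian random variables with variance σ², and set S = WWᵀ. Then E[tr(S⁵)] = σ¹⁰ · n m · (n⁴ + m⁴ + 10n³m + 10nm³ + 20n²m² + 10n³ + 10m³ + 55n²m + 55nm² + 65n² + 65m² + 175nm + 160n + 160m + 148). -/

import Mathlib

open Matrix MeasureTheory ProbabilityTheory

/-- The law of a random real `m × n` matrix with i.i.d. centered Gaussian entries of
variance `σ²`: the product over all entries of the Gaussian measure `N(0, σ²)` on `ℝ`. -/
noncomputable def gaussianMatrixMeasure (m n : ℕ) (σ : ℝ) :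
    Measure (Fin m → Fin n → ℝ) :=
  Measure.pi fun _ => Measure.pi fun _ => gaussianReal 0 ⟨σ ^ 2, sq_nonneg σ⟩


/-- Moments of the centered Gaussian. -/
noncomputable def gMom (v : NNReal) (k : ℕ) : ℝ := ∫ x, x ^ k ∂(gaussianReal 0 v)

lemma integrable_pow_gaussianReal (v : NNReal) (k : ℕ) :
    Integrable (fun x : ℝ => x ^ k) (gaussianReal 0 v) := by
  have h := integrable_pow_of_mem_interior_integrableExpSet (X := id) (μ := gaussianReal 0 v)
    (by simp) k
  simpa using h

lemma integrable_pow_pdf {v : NNReal} (hv : v ≠ 0) (k : ℕ) :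
    Integrable (fun x : ℝ => x ^ k * gaussianPDFReal 0 v x) := by
  have hv' : (0 : ℝ) < v := by positivity
  have h := (integrable_rpow_mul_exp_neg_mul_sq (b := (2 * (v : ℝ))⁻¹) (by positivity)
    (s := (k : ℝ)) (by have : (0:ℝ) ≤ k := by positivity
                       linarith)).const_mul (√(2 * Real.pi * v))⁻¹
  refine h.congr (ae_of_all _ fun x => ?_)
  simp only [Real.rpow_natCast, gaussianPDFReal, sub_zero]
  have : -(2 * (v : ℝ))⁻¹ * x ^ 2 = -x ^ 2 / (2 * v) := by field_simp
  rw [this]; ring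

lemma gMom_succ {v : NNReal} (hv : v ≠ 0) (k : ℕ) :
    gMom v (k + 1) = v * (k * gMom v (k - 1)) := by
  have hv' : (v : ℝ) ≠ 0 := by simpa using hv
  have hd : ∀ x : ℝ, HasDerivAt (fun x : ℝ => x ^ k * gaussianPDFReal 0 v x)
      ((k : ℝ) * (x ^ (k - 1) * gaussianPDFReal 0 v x)
        - (v : ℝ)⁻¹ * (x ^ (k + 1) * gaussianPDFReal 0 v x)) x := by
    intro x
    have h1 : HasDerivAt (fun x : ℝ => gaussianPDFReal 0 v x)
        ((√(2 * Real.pi * v))⁻¹ * (Real.exp (-(x - 0) ^ 2 / (2 * v)) *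
          (-((2 : ℕ) * (x - 0) ^ (2 - 1) * 1) / (2 * v)))) x := by
      unfold gaussianPDFReal
      exact (((((hasDerivAt_id x).sub_const 0).pow 2).neg.div_const _).exp).const_mul _
    refine ((hasDerivAt_pow k x).mul h1).congr_deriv ?_
    unfold gaussianPDFReal
    field_simp
    ring
  have h0 := integral_eq_zero_of_hasDerivAt_of_integrable hd
    (((integrable_pow_pdf hv _).const_mul _).sub ((integrable_pow_pdf hv _).const_mul _))
    (integrable_pow_pdf hv _)
  rw [integral_sub ((integrable_pow_pdf hv _).const_mul _) ((integrable_pow_pdf hv _).const_mul _),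
    integral_const_mul, integral_const_mul] at h0
  have hM : ∀ j, gMom v j = ∫ x, x ^ j * gaussianPDFReal 0 v x := by
    intro j
    rw [gMom, integral_gaussianReal_eq_integral_smul hv]
    simp [mul_comm]
  rw [hM, hM]
  field_simp at h0
  linarith

/-- The variance as a nonnegative real. -/
noncomputable def gv (σ : ℝ) : NNReal := ⟨σ ^ 2, sq_nonneg σ⟩

lemma gaussianMatrixMeasure_eq (m n : ℕ) (σ : ℝ) : gaussianMatrixMeasure m n σ =
    Measure.pi fun _ => Measure.pi fun _ => gaussianReal 0 (gv σ) := rfl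

section poly
open MvPolynomial

variable {m n : ℕ}

lemma eval_monomial_pi (s : Fin m × Fin n →₀ ℕ) (a : ℝ) (W : Fin m → Fin n → ℝ) :
    eval (fun q => W q.1 q.2) (monomial s a) = a * ∏ i, ∏ j, W i j ^ s (i, j) := by
  rw [eval_monomial, Finsupp.prod_fintype _ _ (by simp), Fintype.prod_prod_type]

lemma integrable_monomial_pi (σ : ℝ) (s : Fin m × Fin n →₀ ℕ) (a : ℝ) :
    Integrable (fun W : Fin m → Fin n → ℝ => eval (fun q => W q.1 q.2) (monomial s a))
      (gaussianMatrixMeasure m n σ) := by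
  simp only [eval_monomial_pi]
  refine Integrable.const_mul ?_ a
  rw [gaussianMatrixMeasure_eq]
  exact Integrable.fintype_prod (f := fun i (w : Fin n → ℝ) => ∏ j, w j ^ s (i, j)) fun i =>
    Integrable.fintype_prod (f := fun j (x : ℝ) => x ^ s (i, j)) fun j =>
      integrable_pow_gaussianReal _ _

lemma integrable_poly (σ : ℝ) (p : MvPolynomial (Fin m × Fin n) ℝ) :
    Integrable (fun W : Fin m → Fin n → ℝ => eval (fun q => W q.1 q.2) p)
      (gaussianMatrixMeasure m n σ) := by
  induction p using MvPolynomial.induction_on' with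
  | monomial s a => exact integrable_monomial_pi σ s a
  | add p q hp hq => simp only [map_add]; exact hp.add hq

/-- Expectation as a linear functional on polynomials. -/
noncomputable def gExp (m n : ℕ) (σ : ℝ) : MvPolynomial (Fin m × Fin n) ℝ →ₗ[ℝ] ℝ where
  toFun p := ∫ W : Fin m → Fin n → ℝ, eval (fun q => W q.1 q.2) p ∂(gaussianMatrixMeasure m n σ)
  map_add' p q := by
    simp only [map_add]
    exact integral_add (integrable_poly σ p) (integrable_poly σ q)
  map_smul' c p := by
    simp [smul_eval, integral_const_mul]

lemma gExp_monomial (σ : ℝ) (s : Fin m × Fin n →₀ ℕ) (a : ℝ) :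
    gExp m n σ (monomial s a) = a * ∏ q, gMom (gv σ) (s q) := by
  change ∫ W : Fin m → Fin n → ℝ, eval (fun q => W q.1 q.2) (monomial s a)
    ∂(gaussianMatrixMeasure m n σ) = _
  simp only [eval_monomial_pi, integral_const_mul]
  congr 1
  rw [gaussianMatrixMeasure_eq]
  rw [integral_fintype_prod_eq_prod (f := fun i (w : Fin n → ℝ) => ∏ j, w j ^ s (i, j)),
    Fintype.prod_prod_type]
  refine Finset.prod_congr rfl fun i _ => ?_
  rw [integral_fintype_prod_eq_prod (f := fun j (x : ℝ) => x ^ s (i, j))]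
  rfl

/-- Stein's identity for polynomials. -/
lemma gExp_stein {σ : ℝ} (hσ : 0 < σ) (q : Fin m × Fin n) (p : MvPolynomial (Fin m × Fin n) ℝ) :
    gExp m n σ (X q * p) = σ ^ 2 * gExp m n σ (pderiv q p) := by
  induction p using MvPolynomial.induction_on' with
  | add p r hp hr => rw [mul_add, map_add, map_add, map_add, hp, hr, mul_add]
  | monomial s a =>
    have hv : gv σ ≠ 0 := by
      intro h
      have h2 : σ ^ 2 = 0 := congrArg NNReal.toReal h
      exact hσ.ne' (by simpa using h2)
    rw [X, monomial_mul, one_mul, pderiv_monomial, gExp_monomial, gExp_monomial,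
      Fintype.prod_eq_mul_prod_compl q, Fintype.prod_eq_mul_prod_compl q]
    have e1 : ∀ t ∈ ({q}ᶜ : Finset (Fin m × Fin n)), (Finsupp.single q 1 + s : Fin m × Fin n →₀ ℕ) t = s t := by
      intro t ht
      have : q ≠ t := by simpa [eq_comm] using ht
      simp [this]
    have e2 : ∀ t ∈ ({q}ᶜ : Finset (Fin m × Fin n)), (s - Finsupp.single q 1 : Fin m × Fin n →₀ ℕ) t = s t := by
      intro t ht
      have : q ≠ t := by simpa [eq_comm] using ht
      simp [this]
    have f1 := Finset.prod_congr rfl fun t ht => congrArg (gMom (gv σ)) (e1 t ht)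
    have f2 := Finset.prod_congr rfl fun t ht => congrArg (gMom (gv σ)) (e2 t ht)
    rw [f1, f2]
    have e3 : (Finsupp.single q 1 + s : Fin m × Fin n →₀ ℕ) q = s q + 1 := by simp [add_comm]
    have e4 : (s - Finsupp.single q 1 : Fin m × Fin n →₀ ℕ) q = s q - 1 := by simp
    rw [e3, e4, gMom_succ hv]
    change _ * (σ ^ 2 * _ * _) = _
    ring

variable (m n) in
/-- The generic matrix. -/
noncomputable def gW : Matrix (Fin m) (Fin n) (MvPolynomial (Fin m × Fin n) ℝ) :=
  Matrix.of fun i j => X (i, j)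

variable (m n) in
/-- The generic Gram matrix. -/
noncomputable def gS : Matrix (Fin m) (Fin m) (MvPolynomial (Fin m × Fin n) ℝ) :=
  gW m n * (gW m n)ᵀ

variable (m n) in
/-- Power sums. -/
noncomputable def gp (k : ℕ) : MvPolynomial (Fin m × Fin n) ℝ := (gS m n ^ k).trace

lemma gS_pow_symm (k : ℕ) (i j : Fin m) : (gS m n ^ k) i j = (gS m n ^ k) j i := by
  have : (gS m n ^ k)ᵀ = gS m n ^ k := by
    rw [Matrix.transpose_pow]; congr 1
    simp [gS, Matrix.transpose_mul]
  exact (congrFun (congrFun this i) j).symm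

lemma pderiv_gW (q : Fin m × Fin n) (i : Fin m) (j : Fin n) :
    pderiv q (gW m n i j) = (1 : Matrix _ _ (MvPolynomial (Fin m × Fin n) ℝ)) q.1 i *
      (1 : Matrix _ _ (MvPolynomial (Fin m × Fin n) ℝ)) q.2 j := by
  rcases q with ⟨a, b⟩
  simp only [gW, Matrix.of_apply, pderiv_X, Pi.single_apply, Matrix.one_apply, Prod.mk.injEq]
  by_cases h1 : a = i <;> by_cases h2 : b = j <;> simp [h1, h2, Ne.symm, eq_comm (a := i), eq_comm (a := j)]

lemma pderiv_gS (i : Fin m) (j : Fin n) (a b : Fin m) :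
    pderiv (i, j) (gS m n a b) =
      (1 : Matrix _ _ (MvPolynomial (Fin m × Fin n) ℝ)) a i * gW m n b j +
      gW m n a j * (1 : Matrix _ _ (MvPolynomial (Fin m × Fin n) ℝ)) i b := by
  simp only [gS, Matrix.mul_apply, Matrix.transpose_apply, map_sum, Derivation.leibniz,
    pderiv_gW, smul_eq_mul, Finset.sum_add_distrib]
  simp [Matrix.one_apply, eq_comm]
  ring

lemma pderiv_gS_pow (i : Fin m) (j : Fin n) (k : ℕ) (a b : Fin m) :
    pderiv (i, j) ((gS m n ^ k) a b) = ∑ c ∈ Finset.range k,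
      ((gS m n ^ c) a i * (gS m n ^ (k - 1 - c) * gW m n) b j +
       (gS m n ^ c * gW m n) a j * (gS m n ^ (k - 1 - c)) i b) := by
  induction k generalizing a b with
  | zero => by_cases h : a = b <;> simp [Matrix.one_apply, h]
  | succ k ih =>
    rw [pow_succ', Matrix.mul_apply, map_sum]
    simp only [Derivation.leibniz, smul_eq_mul]
    rw [Finset.sum_add_distrib]
    simp only [ih]
    have e1 : ∑ x, (gS m n ^ k) x b * pderiv (i, j) (gS m n a x) =
        (gS m n ^ 0) a i * (gS m n ^ k * gW m n) b j +
       ((gS m n ^ 0 * gW m n : Matrix _ _ _)) a j * (gS m n ^ k) i b := by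
      simp only [pderiv_gS, mul_add, Finset.sum_add_distrib, pow_zero, Matrix.one_mul]
      congr 1
      · rw [Matrix.mul_apply, Finset.mul_sum]
        refine Finset.sum_congr rfl fun x _ => ?_
        rw [gS_pow_symm k x b]; ring
      · simp [Matrix.one_apply]; ring
    rw [e1, Finset.sum_range_succ']
    simp only [Nat.add_sub_cancel, Nat.sub_zero]
    congr 1
    have hA : ∀ c, (gS m n ^ (c + 1)) a i = ∑ x, gS m n a x * (gS m n ^ c) x i := by
      intro c; rw [pow_succ', Matrix.mul_apply]
    have hB : ∀ c, (gS m n ^ (c + 1) * gW m n : Matrix _ _ _) a j =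
        ∑ x, gS m n a x * (gS m n ^ c * gW m n : Matrix _ _ _) x j := by
      intro c; rw [pow_succ', Matrix.mul_assoc, Matrix.mul_apply]
    simp only [Finset.mul_sum]
    rw [Finset.sum_comm]
    refine Finset.sum_congr rfl fun c _ => ?_
    rw [hA, hB, Finset.sum_mul, Finset.sum_mul, ← Finset.sum_add_distrib, Nat.sub_sub,
      Nat.add_comm 1 c]
    refine Finset.sum_congr rfl fun x _ => ?_
    ring

lemma sum_pow_mul (k l : ℕ) : ∑ i, ∑ j, (gS m n ^ k * gW m n) i j * (gS m n ^ l * gW m n) i j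
    = gp m n (k + l + 1) := by
  have h : gS m n ^ (k + l + 1) = (gS m n ^ k * gW m n) * (gS m n ^ l * gW m n)ᵀ := by
    have : (gS m n ^ l)ᵀ = gS m n ^ l := by ext1 i j; exact gS_pow_symm _ _ _
    rw [Matrix.transpose_mul, this, Matrix.mul_assoc, ← Matrix.mul_assoc (gW m n)]
    change _ = gS m n ^ k * (gS m n * gS m n ^ l)
    rw [← pow_succ', ← pow_add, add_assoc]
  rw [gp, h]
  rfl

lemma pderiv_gp (i : Fin m) (j : Fin n) (k : ℕ) :
    pderiv (i, j) (gp m n (k + 1)) = (2 * (k + 1 : ℝ)) • (gS m n ^ k * gW m n) i j := by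
  simp only [gp, Matrix.trace, Matrix.diag_apply, map_sum, pderiv_gS_pow]
  rw [Finset.sum_comm]
  have : ∀ c ∈ Finset.range (k + 1), ∑ a, ((gS m n ^ c) a i *
      (gS m n ^ (k + 1 - 1 - c) * gW m n) a j +
       (gS m n ^ c * gW m n) a j * (gS m n ^ (k + 1 - 1 - c)) i a) =
       (2 : ℝ) • (gS m n ^ k * gW m n) i j := by
    intro c hc
    have hc' : c ≤ k := by simpa [Nat.lt_succ_iff] using hc
    rw [Finset.sum_add_distrib, two_smul]
    congr 1
    · conv_rhs => rw [← Nat.add_sub_cancel' hc', pow_add, Matrix.mul_assoc, Matrix.mul_apply]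
      refine Finset.sum_congr rfl fun a _ => ?_
      rw [gS_pow_symm c a i]; rfl
    · conv_rhs => rw [← Nat.sub_add_cancel hc', pow_add, Matrix.mul_assoc, Matrix.mul_apply]
      refine Finset.sum_congr rfl fun a _ => ?_
      rw [mul_comm]; rfl
  rw [Finset.sum_congr rfl this, Finset.sum_const, Finset.card_range, ← Nat.cast_smul_eq_nsmul ℝ,
    smul_smul]
  congr 1
  push_cast; ring

lemma gdiv_pow (k : ℕ) : ∑ i, ∑ j, pderiv (i, j) ((gS m n ^ k * gW m n) i j) =
    (n + k : ℝ) • gp m n k + ∑ c ∈ Finset.range k, gp m n c * gp m n (k - c) := by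
  have key : ∀ i j, pderiv (i, j) ((gS m n ^ k * gW m n) i j) =
      (gS m n ^ k) i i + ∑ c ∈ Finset.range k,
        ((gS m n ^ c) i i * ∑ b, (gS m n ^ (k - 1 - c) * gW m n) b j * ((gS m n ^ 0 * gW m n : Matrix _ _ _)) b j
        + (gS m n ^ c * gW m n) i j * (gS m n ^ (k - 1 - c) * gW m n) i j) := by
    intro i j
    rw [Matrix.mul_apply, map_sum]
    simp only [Derivation.leibniz, smul_eq_mul, Finset.sum_add_distrib]
    rw [← Finset.sum_add_distrib (s := Finset.range k)]
    congr 1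
    · simp [pderiv_gW, Matrix.one_apply]
    · simp only [pderiv_gS_pow, Finset.mul_sum]
      rw [Finset.sum_comm]
      refine Finset.sum_congr rfl fun c _ => ?_
      rw [Matrix.mul_apply (M := gS m n ^ (k - 1 - c)) (N := gW m n) (i := i), Finset.mul_sum,
        ← Finset.sum_add_distrib]
      refine Finset.sum_congr rfl fun x _ => ?_
      simp only [pow_zero, Matrix.one_mul]
      ring
  simp only [key, Finset.sum_add_distrib]
  rw [add_smul, add_assoc]
  congr 1
  · simp [gp, Matrix.trace, Finset.mul_sum, Algebra.smul_def]
  · rw [add_comm]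
    congr 1
    · have : ∀ c ∈ Finset.range k, ∑ i, ∑ j, (gS m n ^ c * gW m n) i j *
          (gS m n ^ (k - 1 - c) * gW m n) i j = gp m n k := by
        intro c hc
        rw [sum_pow_mul]
        congr 1
        have := Finset.mem_range.1 hc
        omega
      simp only [Finset.sum_comm (t := Finset.range k)]
      rw [Finset.sum_congr rfl this]
      simp [Algebra.smul_def]
    · simp only [Finset.sum_comm (t := Finset.range k)]
      refine Finset.sum_congr rfl fun c hc => ?_
      have h := sum_pow_mul (m := m) (n := n) (k - 1 - c) 0
      have e : k - 1 - c + 0 + 1 = k - c := by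
        have := Finset.mem_range.1 hc
        omega
      rw [e, Finset.sum_comm] at h
      rw [← h]
      simp only [← Finset.mul_sum]
      rw [← Finset.sum_mul]
      rfl

lemma gExp_rec {σ : ℝ} (hσ : 0 < σ) (k : ℕ) (F : MvPolynomial (Fin m × Fin n) ℝ) :
    gExp m n σ (gp m n (k + 1) * F) = σ ^ 2 * gExp m n σ
      (((n + k : ℝ) • gp m n k + ∑ c ∈ Finset.range k, gp m n c * gp m n (k - c)) * F +
        ∑ i, ∑ j, (gS m n ^ k * gW m n) i j * pderiv (i, j) F) := by
  have h := sum_pow_mul (m := m) (n := n) 0 k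
  rw [zero_add] at h
  rw [← h, ← gdiv_pow]
  simp only [Finset.sum_mul, map_sum, ← Finset.sum_add_distrib, Finset.mul_sum]
  refine Finset.sum_congr rfl fun i _ => Finset.sum_congr rfl fun j _ => ?_
  rw [pow_zero, Matrix.one_mul, mul_assoc]
  change gExp m n σ (X (i, j) * _) = _
  rw [gExp_stein hσ, Derivation.leibniz]
  simp only [smul_eq_mul]
  congr 2
  ring

lemma gExp_rec_one {σ : ℝ} (hσ : 0 < σ) (k : ℕ) :
    gExp m n σ (gp m n (k + 1)) = σ ^ 2 * gExp m n σ
      ((n + k : ℝ) • gp m n k + ∑ c ∈ Finset.range k, gp m n c * gp m n (k - c)) := by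
  have h := gExp_rec (m := m) (n := n) hσ k 1
  simpa using h

lemma gExp_rec_gp {σ : ℝ} (hσ : 0 < σ) (k l : ℕ) :
    gExp m n σ (gp m n (k + 1) * gp m n (l + 1)) = σ ^ 2 * gExp m n σ
      (((n + k : ℝ) • gp m n k + ∑ c ∈ Finset.range k, gp m n c * gp m n (k - c)) *
        gp m n (l + 1) + (2 * (l + 1 : ℝ)) • gp m n (k + l + 1)) := by
  rw [gExp_rec hσ, ← sum_pow_mul k l]
  simp only [pderiv_gp, mul_smul_comm, Finset.smul_sum]

lemma gp_zero : gp m n 0 = C (m : ℝ) := by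
  simp [gp, Matrix.trace_one]

lemma gExp_one (σ : ℝ) : gExp m n σ 1 = 1 := by
  have h := gExp_monomial (m := m) (n := n) σ 0 1
  have h0 : gMom (gv σ) 0 = 1 := by simp [gMom]
  simpa [h0] using h

lemma gExp_p5 {σ : ℝ} (hσ : 0 < σ) : gExp m n σ (gp m n 5) = σ ^ 10 * ((n : ℝ) * m) *
        ((n : ℝ) ^ 4 + (m : ℝ) ^ 4 + 10 * (n : ℝ) ^ 3 * m + 10 * n * (m : ℝ) ^ 3 +
          20 * (n : ℝ) ^ 2 * (m : ℝ) ^ 2 + 10 * (n : ℝ) ^ 3 + 10 * (m : ℝ) ^ 3 +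
          55 * (n : ℝ) ^ 2 * m + 55 * n * (m : ℝ) ^ 2 + 65 * (n : ℝ) ^ 2 +
          65 * (m : ℝ) ^ 2 + 175 * n * m + 160 * n + 160 * m + 148) := by
  have h1 := gExp_rec_one (m := m) (n := n) hσ 0
  have h2 := gExp_rec_one (m := m) (n := n) hσ 1
  have h3 := gExp_rec_one (m := m) (n := n) hσ 2
  have h4 := gExp_rec_one (m := m) (n := n) hσ 3
  have h5 := gExp_rec_one (m := m) (n := n) hσ 4
  have h11 := gExp_rec_gp (m := m) (n := n) hσ 0 0
  have h12 := gExp_rec_gp (m := m) (n := n) hσ 0 1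
  have h13 := gExp_rec_gp (m := m) (n := n) hσ 0 2
  have h22 := gExp_rec_gp (m := m) (n := n) hσ 1 1
  have hone := gExp_one (m := m) (n := n) σ
  have hC : gExp m n σ (C (m : ℝ)) = m := by
    rw [← mul_one (C (m : ℝ)), ← smul_eq_C_mul, map_smul, hone]; simp
  have c21 : gp m n 2 * gp m n 1 = gp m n 1 * gp m n 2 := mul_comm _ _
  have c31 : gp m n 3 * gp m n 1 = gp m n 1 * gp m n 3 := mul_comm _ _
  simp only [Finset.sum_range_succ, Finset.sum_range_zero, gp_zero, ← smul_eq_C_mul, map_add,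
    map_smul, add_mul, smul_mul_assoc, zero_add, Nat.reduceAdd, Nat.reduceSub, Nat.sub_zero,
    smul_eq_mul, c21, c31, hC, zero_mul, map_zero, Nat.cast_zero, Nat.cast_one, Nat.cast_ofNat,
    add_zero] at h1 h2 h3 h4 h5 h11 h12 h13 h22
  rw [h5, h4, h13, h22, h12, h3, h11, h2, h1]
  ring

end poly

/-- With `W` a random real `m × n` matrix with i.i.d. centered Gaussian
entries of variance `σ²` and `S = W Wᵀ`, one has
`E[tr (S⁵)] = σ¹⁰ n m (n⁴ + m⁴ + 10 n³ m + 10 n m³ + 20 n² m² + 10 n³ + 10 m³ + 55 n² m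
+ 55 n m² + 65 n² + 65 m² + 175 n m + 160 n + 160 m + 148)`. -/
theorem stmt_13 (m n : ℕ) (hm : 0 < m) (hn : 0 < n) (σ : ℝ) (hσ : 0 < σ) :
    ∫ W : Fin m → Fin n → ℝ, ((Matrix.of W * (Matrix.of W)ᵀ) ^ 5).trace
        ∂(gaussianMatrixMeasure m n σ) =
      σ ^ 10 * ((n : ℝ) * m) *
        ((n : ℝ) ^ 4 + (m : ℝ) ^ 4 + 10 * (n : ℝ) ^ 3 * m + 10 * n * (m : ℝ) ^ 3 +
          20 * (n : ℝ) ^ 2 * (m : ℝ) ^ 2 + 10 * (n : ℝ) ^ 3 + 10 * (m : ℝ) ^ 3 +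
          55 * (n : ℝ) ^ 2 * m + 55 * n * (m : ℝ) ^ 2 + 65 * (n : ℝ) ^ 2 +
          65 * (m : ℝ) ^ 2 + 175 * n * m + 160 * n + 160 * m + 148) := by
  rw [← gExp_p5 hσ]
  change _ = ∫ W : Fin m → Fin n → ℝ, MvPolynomial.eval (fun q => W q.1 q.2) (gp m n 5)
    ∂(gaussianMatrixMeasure m n σ)
  refine integral_congr_ae (ae_of_all _ fun W => ?_)
  have hS : (gS m n).map (MvPolynomial.eval fun q : Fin m × Fin n => W q.1 q.2) =
      Matrix.of W * (Matrix.of W)ᵀ := by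
    ext i j; simp [gS, gW, Matrix.mul_apply]
  have h5 : (gS m n ^ 5).map (MvPolynomial.eval fun q : Fin m × Fin n => W q.1 q.2) =
      (Matrix.of W * (Matrix.of W)ᵀ) ^ 5 := by
    rw [← hS, ← RingHom.mapMatrix_apply, map_pow]; rfl
  simp only [gp, ← h5]
  simp [Matrix.trace, map_sum]
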